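/- Every point of the complex unit sphere S_ℂ^7 lies in the compact orbit of the slice T̃_0 = {cosh θ·e_0 + i sinh θ·e_1 : θ ∈ ℝ}: for every v ∈ ℂ^8 with (v,v) = 1 there exist k ∈ Spin(7) and θ ∈ ℝ such that v = k(cosh θ·e_0 + i sinh θ·e_1). -/

import Mathlib

open Matrix

noncomputable section

/-- The standard basis of the complexified Cayley algebra `𝕆_ℂ = ℂ^8`. -/
def e (i : Fin 8) : Fin 8 → ℂ := Pi.single i 1

/-- The oriented lines of the multiplication table of the Cayley algebra:
`(i, j, k)` in this list means `e_i e_j = e_k`. -/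
def octLines : List (Fin 8 × Fin 8 × Fin 8) :=
  [(1,2,3),(2,3,1),(3,1,2),
   (1,4,5),(4,5,1),(5,1,4),
   (1,6,7),(6,7,1),(7,1,6),
   (2,5,7),(5,7,2),(7,2,5),
   (2,6,4),(6,4,2),(4,2,6),
   (3,5,6),(5,6,3),(6,3,5),
   (3,4,7),(4,7,3),(7,3,4)]

/-- Product of two basis elements of the complexified Cayley algebra. -/
def octBasisMul (i j : Fin 8) : Fin 8 → ℂ :=
  if i = 0 then e j
  else if j = 0 then e i
  else if i = j then -(e 0)
  else
    match octLines.find? (fun t => t.1 == i && t.2.1 == j) with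
    | some t => e t.2.2
    | none =>
      match octLines.find? (fun t => t.1 == j && t.2.1 == i) with
      | some t => -(e t.2.2)
      | none => 0

/-- The bilinear multiplication of the complexified Cayley algebra `𝕆_ℂ`. -/
def octMul (x y : Fin 8 → ℂ) : Fin 8 → ℂ :=
  ∑ i, ∑ j, (x i * y j) • octBasisMul i j

/-- The standard symmetric bilinear form on `ℂ^8`. -/
def bform (v w : Fin 8 → ℂ) : ℂ := ∑ i, v i * w i

/-- `SO(8, ℂ)`. -/
def SO8 (g : Matrix (Fin 8) (Fin 8) ℂ) : Prop := gᵀ * g = 1 ∧ g.det = 1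

/-- A matrix has real entries. -/
def realMat (g : Matrix (Fin 8) (Fin 8) ℂ) : Prop := ∀ i j, (g i j).im = 0

/-- The realization of `G₂(ℂ)` as automorphisms of `𝕆_ℂ`. -/
def inG2 (g : Matrix (Fin 8) (Fin 8) ℂ) : Prop :=
  SO8 g ∧ ∀ x y, g.mulVec (octMul x y) = octMul (g.mulVec x) (g.mulVec y)

/-- The compact real form `G₂`. -/
def inG2cpt (g : Matrix (Fin 8) (Fin 8) ℂ) : Prop := inG2 g ∧ realMat g

/-- The realization `B₃(ℂ)` of `Spin(7, ℂ)`. -/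
def inB3 (g : Matrix (Fin 8) (Fin 8) ℂ) : Prop :=
  SO8 g ∧ ∃ g₀, SO8 g₀ ∧ g₀.mulVec (e 0) = e 0 ∧
    ∀ x y, octMul (g₀.mulVec x) (g.mulVec y) = g.mulVec (octMul x y)

/-- The compact real form `Spin(7)`. -/
def inSpin7 (g : Matrix (Fin 8) (Fin 8) ℂ) : Prop :=
  SO8 g ∧ realMat g ∧ ∃ g₀, SO8 g₀ ∧ realMat g₀ ∧ g₀.mulVec (e 0) = e 0 ∧
    ∀ x y, octMul (g₀.mulVec x) (g.mulVec y) = g.mulVec (octMul x y)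

/-- The one-parameter group `t_θ` (abelian slice `A₁` for `(G₂(ℂ), SL(3,ℂ))`). -/
def tmat (θ : ℝ) : Matrix (Fin 8) (Fin 8) ℂ :=
  Matrix.of fun i j =>
    (![ e 0,
        (Real.cosh θ : ℂ) • e 1 + (Complex.I * (Real.sinh θ : ℂ)) • e 2,
        (-(Complex.I * (Real.sinh θ : ℂ))) • e 1 + (Real.cosh θ : ℂ) • e 2,
        e 3,
        (Real.cosh (θ/2) : ℂ) • e 4 + (-(Complex.I * (Real.sinh (θ/2) : ℂ))) • e 7,
        (Real.cosh (θ/2) : ℂ) • e 5 + (-(Complex.I * (Real.sinh (θ/2) : ℂ))) • e 6,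
        (Complex.I * (Real.sinh (θ/2) : ℂ)) • e 5 + (Real.cosh (θ/2) : ℂ) • e 6,
        (Complex.I * (Real.sinh (θ/2) : ℂ)) • e 4 + (Real.cosh (θ/2) : ℂ) • e 7 ] j) i

/-- The generator `τ₁` of the one-parameter group `A₁`, i.e. `exp (θ τ₁) = t_θ`. -/
def tau1 : Matrix (Fin 8) (Fin 8) ℂ :=
  Matrix.of fun i j =>
    (![ 0,
        Complex.I • e 2,
        (-Complex.I) • e 1,
        0,
        (-(Complex.I/2)) • e 7,
        (-(Complex.I/2)) • e 6,
        (Complex.I/2) • e 5,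
        (Complex.I/2) • e 4 ] j) i

/-- The one-parameter group `ã_θ` (abelian slice `Ã₀` for `(Spin(7,ℂ), G₂(ℂ))`). -/
def atil (θ : ℝ) : Matrix (Fin 8) (Fin 8) ℂ :=
  Matrix.of fun i j =>
    (![ (Real.cosh θ : ℂ) • e 0 + (Complex.I * (Real.sinh θ : ℂ)) • e 1,
        (-(Complex.I * (Real.sinh θ : ℂ))) • e 0 + (Real.cosh θ : ℂ) • e 1,
        (Real.cosh (θ/3) : ℂ) • e 2 + (-(Complex.I * (Real.sinh (θ/3) : ℂ))) • e 3,
        (Complex.I * (Real.sinh (θ/3) : ℂ)) • e 2 + (Real.cosh (θ/3) : ℂ) • e 3,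
        (Real.cosh (θ/3) : ℂ) • e 4 + (-(Complex.I * (Real.sinh (θ/3) : ℂ))) • e 5,
        (Complex.I * (Real.sinh (θ/3) : ℂ)) • e 4 + (Real.cosh (θ/3) : ℂ) • e 5,
        (Real.cosh (θ/3) : ℂ) • e 6 + (-(Complex.I * (Real.sinh (θ/3) : ℂ))) • e 7,
        (Complex.I * (Real.sinh (θ/3) : ℂ)) • e 6 + (Real.cosh (θ/3) : ℂ) • e 7 ] j) i

/-- The generator `α̃₁` of the one-parameter group `Ã₀`, i.e. `exp (θ α̃₁) = ã_θ`. -/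
def alphatil1 : Matrix (Fin 8) (Fin 8) ℂ :=
  Matrix.of fun i j =>
    (![ Complex.I • e 1,
        (-Complex.I) • e 0,
        (-(Complex.I/3)) • e 3,
        (Complex.I/3) • e 2,
        (-(Complex.I/3)) • e 5,
        (Complex.I/3) • e 4,
        (-(Complex.I/3)) • e 7,
        (Complex.I/3) • e 6 ] j) i

/-- The one-parameter group `a_x` (abelian slice `A₀` for `(SO(7,ℂ), G₂(ℂ))`). -/
def amat (x : ℝ) : Matrix (Fin 8) (Fin 8) ℂ :=
  Matrix.of fun i j =>
    (![ e 0,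
        e 1,
        (Real.cosh x : ℂ) • e 2 + (Complex.I * (Real.sinh x : ℂ)) • e 3,
        (-(Complex.I * (Real.sinh x : ℂ))) • e 2 + (Real.cosh x : ℂ) • e 3,
        (Real.cosh x : ℂ) • e 4 + (Complex.I * (Real.sinh x : ℂ)) • e 5,
        (-(Complex.I * (Real.sinh x : ℂ))) • e 4 + (Real.cosh x : ℂ) • e 5,
        (Real.cosh x : ℂ) • e 6 + (Complex.I * (Real.sinh x : ℂ)) • e 7,
        (-(Complex.I * (Real.sinh x : ℂ))) • e 6 + (Real.cosh x : ℂ) • e 7 ] j) i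

/-- The matrix `I₊₋ = diag(1, −1, 1, −1, 1, −1, 1, −1)`. -/
def Ipm : Matrix (Fin 8) (Fin 8) ℂ :=
  Matrix.diagonal ![1, -1, 1, -1, 1, -1, 1, -1]

/-- The anti-holomorphic involution `σ₀(g) = I₊₋ ḡ I₊₋`. -/
def sigma0 (g : Matrix (Fin 8) (Fin 8) ℂ) : Matrix (Fin 8) (Fin 8) ℂ :=
  Ipm * g.map (starRingEnd ℂ) * Ipm

end

set_option maxHeartbeats 4000000 in
/-- The multiplication of the complexified Cayley algebra in coordinates. -/
theorem octMul_eq (x y : Fin 8 → ℂ) :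
    octMul x y =
    ![x 0 * y 0 - x 1 * y 1 - x 2 * y 2 - x 3 * y 3 - x 4 * y 4 - x 5 * y 5 - x 6 * y 6 - x 7 * y 7,
      x 0 * y 1 + x 1 * y 0 + x 2 * y 3 - x 3 * y 2 + x 4 * y 5 - x 5 * y 4 + x 6 * y 7 - x 7 * y 6,
      x 0 * y 2 - x 1 * y 3 + x 2 * y 0 + x 3 * y 1 - x 4 * y 6 + x 5 * y 7 + x 6 * y 4 - x 7 * y 5,
      x 0 * y 3 + x 1 * y 2 - x 2 * y 1 + x 3 * y 0 + x 4 * y 7 + x 5 * y 6 - x 6 * y 5 - x 7 * y 4,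
      x 0 * y 4 - x 1 * y 5 + x 2 * y 6 - x 3 * y 7 + x 4 * y 0 + x 5 * y 1 - x 6 * y 2 + x 7 * y 3,
      x 0 * y 5 + x 1 * y 4 - x 2 * y 7 - x 3 * y 6 - x 4 * y 1 + x 5 * y 0 + x 6 * y 3 + x 7 * y 2,
      x 0 * y 6 - x 1 * y 7 - x 2 * y 4 + x 3 * y 5 + x 4 * y 2 - x 5 * y 3 + x 6 * y 0 + x 7 * y 1,
      x 0 * y 7 + x 1 * y 6 + x 2 * y 5 + x 3 * y 4 - x 4 * y 3 - x 5 * y 2 - x 6 * y 1 + x 7 * y 0] := by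
  ext k
  simp only [octMul, Fin.sum_univ_eight, octBasisMul, octLines, e]
  fin_cases k <;> simp <;> ring

/-- A vector of `ℂ^8` has real entries. -/
def RealVec (v : Fin 8 → ℂ) : Prop := ∀ i, (v i).im = 0

/-- `u` is a unit vector in the imaginary part of the real Cayley algebra. -/
structure IsImagUnit (u : Fin 8 → ℂ) : Prop where
  real : RealVec u
  zero : u 0 = 0
  norm : bform u u = 1

theorem octMul_zero (x y : Fin 8 → ℂ) : octMul x y 0 = 2 * x 0 * y 0 - bform x y := by
  simp only [octMul_eq, bform, Fin.sum_univ_eight, Matrix.cons_val]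
  ring

theorem RealVec.octMul {x y : Fin 8 → ℂ} (hx : RealVec x) (hy : RealVec y) :
    RealVec (octMul x y) := by
  have hx' : ∀ i, (x i).im = 0 := hx
  have hy' : ∀ i, (y i).im = 0 := hy
  intro k
  rw [octMul_eq]
  fin_cases k <;> simp [hx', hy']

theorem octMul_smul (c : ℂ) (x y : Fin 8 → ℂ) : octMul x (c • y) = c • octMul x y := by
  ext k
  rw [octMul_eq, octMul_eq]
  fin_cases k <;> simp <;> ring

theorem octMul_add (x y z : Fin 8 → ℂ) : octMul x (y + z) = octMul x y + octMul x z := by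
  ext k
  rw [octMul_eq, octMul_eq, octMul_eq]
  fin_cases k <;> simp <;> ring

theorem octMul_e_zero (x : Fin 8 → ℂ) : octMul x (e 0) = x := by
  ext k
  rw [octMul_eq]
  fin_cases k <;> simp [e]

theorem bform_octMul_octMul (x y z : Fin 8 → ℂ) :
    bform (octMul x y) (octMul x z) = bform x x * bform y z := by
  simp only [octMul_eq, bform, Fin.sum_univ_eight, Matrix.cons_val]
  ring

theorem octMul_octMul_self {u : Fin 8 → ℂ} (hu : u 0 = 0) (y : Fin 8 → ℂ) :
    octMul u (octMul u y) = -(bform u u • y) := by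
  ext k
  simp only [octMul_eq u, bform, Fin.sum_univ_eight, hu]
  fin_cases k <;> simp <;> ring

theorem octMul_self_octMul {u : Fin 8 → ℂ} (hu : u 0 = 0) (y : Fin 8 → ℂ) :
    octMul (octMul y u) u = -(bform u u • y) := by
  ext k
  simp only [octMul_eq _ u, bform, Fin.sum_univ_eight, hu]
  fin_cases k <;> simp <;> ring

theorem octMul_anticomm {x y : Fin 8 → ℂ} (hx : x 0 = 0) (hy : y 0 = 0) (h : bform x y = 0) :
    octMul x y = -octMul y x := by
  simp only [bform, Fin.sum_univ_eight, hx, hy] at h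
  ext k
  rw [octMul_eq, octMul_eq]
  fin_cases k <;> simp [hx, hy]
  on_goal 1 => linear_combination -2 * h
  all_goals ring

/-- The linearized right alternative law, for orthogonal imaginary elements. -/
theorem octMul_right_anticomm (x : Fin 8 → ℂ) {y z : Fin 8 → ℂ} (hy : y 0 = 0) (hz : z 0 = 0)
    (h : bform y z = 0) : octMul (octMul x y) z = -octMul (octMul x z) y := by
  simp only [bform, Fin.sum_univ_eight, hy, hz] at h
  ext k
  simp only [octMul_eq _ z, octMul_eq _ y, hy, hz]
  fin_cases k <;> simp
  · linear_combination -2 * x 0 * h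
  · linear_combination -2 * x 1 * h
  · linear_combination -2 * x 2 * h
  · linear_combination -2 * x 3 * h
  · linear_combination -2 * x 4 * h
  · linear_combination -2 * x 5 * h
  · linear_combination -2 * x 6 * h
  · linear_combination -2 * x 7 * h

set_option maxHeartbeats 4000000 in
/-- The left Moufang identity. -/
theorem octMul_moufang (u x z : Fin 8 → ℂ) :
    octMul u (octMul x (octMul u z)) = octMul (octMul u (octMul x u)) z := by
  ext k
  simp only [octMul_eq]
  fin_cases k <;> simp <;> ring

/-- Left multiplication in the complexified Cayley algebra. -/
noncomputable def leftMul (u : Fin 8 → ℂ) : Matrix (Fin 8) (Fin 8) ℂ :=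
  Matrix.of fun i j => octMul u (e j) i

/-- Right multiplication in the complexified Cayley algebra. -/
noncomputable def rightMul (u : Fin 8 → ℂ) : Matrix (Fin 8) (Fin 8) ℂ :=
  Matrix.of fun i j => octMul (e j) u i

theorem realVec_e (i : Fin 8) : RealVec (e i) := by
  intro j
  by_cases h : j = i <;> simp [e, h]

theorem leftMul_mulVec (u x : Fin 8 → ℂ) : leftMul u *ᵥ x = octMul u x := by
  ext k
  simp only [leftMul, Matrix.mulVec, dotProduct, Fin.sum_univ_eight, Matrix.of_apply, octMul_eq, e]
  fin_cases k <;> simp <;> ring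

theorem rightMul_mulVec (u x : Fin 8 → ℂ) : rightMul u *ᵥ x = octMul x u := by
  ext k
  simp only [rightMul, Matrix.mulVec, dotProduct, Fin.sum_univ_eight, Matrix.of_apply, octMul_eq, e]
  fin_cases k <;> simp <;> ring

theorem leftMul_transpose {u : Fin 8 → ℂ} (hu : u 0 = 0) : (leftMul u)ᵀ = -leftMul u := by
  ext i j
  simp only [leftMul, Matrix.transpose_apply, Matrix.neg_apply, Matrix.of_apply, octMul_eq, e]
  fin_cases i <;> fin_cases j <;> simp [hu]

theorem rightMul_transpose {u : Fin 8 → ℂ} (hu : u 0 = 0) : (rightMul u)ᵀ = -rightMul u := by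
  ext i j
  simp only [rightMul, Matrix.transpose_apply, Matrix.neg_apply, Matrix.of_apply, octMul_eq, e]
  fin_cases i <;> fin_cases j <;> simp [hu]

theorem realMat_det {g : Matrix (Fin 8) (Fin 8) ℂ} (hg : realMat g) : ∃ r : ℝ, g.det = r := by
  refine ⟨(g.map Complex.re).det, ?_⟩
  have h : g = (g.map Complex.re).map (Complex.ofRealHom) := by
    ext i j
    exact Complex.ext (by simp) (by simpa using hg i j)
  conv_lhs => rw [h]
  exact (RingHom.map_det Complex.ofRealHom _).symm

/-- A real orthogonal complex structure has determinant one. -/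
theorem SO8_of_mul_self {g : Matrix (Fin 8) (Fin 8) ℂ} (hg : realMat g) (ht : gᵀ = -g)
    (h : g * g = -1) : SO8 g := by
  refine ⟨by rw [ht, neg_mul, h, neg_neg], ?_⟩
  have hs : realMat (1 + g) := by
    intro i j
    by_cases hij : i = j <;> simp [hij, hg _ _]
  obtain ⟨r, hr⟩ := realMat_det hg
  obtain ⟨s, hs⟩ := realMat_det hs
  have hsq : (1 + g) * (1 + g) = (2 : ℂ) • g := by
    rw [mul_add, add_mul, add_mul, h, two_smul, one_mul, one_mul, mul_one]
    abel
  have h1 := congrArg Matrix.det hsq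
  have h2 := congrArg Matrix.det h
  rw [Matrix.det_mul, Matrix.det_smul, hs, hr] at h1
  rw [Matrix.det_mul, hr, ← neg_one_smul ℂ (1 : Matrix (Fin 8) (Fin 8) ℂ), Matrix.det_smul] at h2
  norm_num at h1 h2
  norm_cast at h1 h2
  rw [hr]
  norm_cast
  nlinarith [mul_self_nonneg s, mul_self_eq_one_iff.mp h2]

theorem realMat.mul {g h : Matrix (Fin 8) (Fin 8) ℂ} (hg : realMat g) (hh : realMat h) :
    realMat (g * h) := by
  intro i j
  simp [Matrix.mul_apply, Complex.mul_im, hg _ _, hh _ _]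

theorem SO8.mul {g h : Matrix (Fin 8) (Fin 8) ℂ} (hg : SO8 g) (hh : SO8 h) : SO8 (g * h) := by
  refine ⟨?_, by rw [Matrix.det_mul, hg.2, hh.2, one_mul]⟩
  rw [Matrix.transpose_mul, Matrix.mul_assoc, ← Matrix.mul_assoc gᵀ, hg.1, Matrix.one_mul, hh.1]

theorem inSpin7.mul {g h : Matrix (Fin 8) (Fin 8) ℂ} (hg : inSpin7 g) (hh : inSpin7 h) :
    inSpin7 (g * h) := by
  obtain ⟨hg, hg', g₀, hg₀, hg₀', hg1, hg2⟩ := hg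
  obtain ⟨hh, hh', h₀, hh₀, hh₀', hh1, hh2⟩ := hh
  refine ⟨hg.mul hh, hg'.mul hh', g₀ * h₀, hg₀.mul hh₀, hg₀'.mul hh₀', ?_, fun x y => ?_⟩
  · rw [← Matrix.mulVec_mulVec, hh1, hg1]
  · rw [← Matrix.mulVec_mulVec, ← Matrix.mulVec_mulVec, ← Matrix.mulVec_mulVec, hg2, hh2]

theorem IsImagUnit.octMul_octMul {u : Fin 8 → ℂ} (hu : IsImagUnit u) (y : Fin 8 → ℂ) :
    octMul u (octMul u y) = -y := by
  rw [octMul_octMul_self hu.zero, hu.norm, one_smul]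

theorem octMul_neg (x y : Fin 8 → ℂ) : octMul x (-y) = -octMul x y := by
  simpa using octMul_smul (-1) x y

theorem neg_octMul (x y : Fin 8 → ℂ) : octMul (-x) y = -octMul x y := by
  ext k
  rw [octMul_eq, octMul_eq]
  fin_cases k <;> simp <;> ring

theorem IsImagUnit.neg {u : Fin 8 → ℂ} (hu : IsImagUnit u) : IsImagUnit (-u) :=
  ⟨fun i => by simp [hu.real i], by simp [hu.zero], by simpa [bform] using hu.norm⟩

theorem IsImagUnit.SO8_leftMul {u : Fin 8 → ℂ} (hu : IsImagUnit u) :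
    realMat (leftMul u) ∧ SO8 (leftMul u) := by
  have hr : realMat (leftMul u) := fun i j => hu.real.octMul (realVec_e j) i
  refine ⟨hr, SO8_of_mul_self hr (leftMul_transpose hu.zero) (Matrix.mulVec_injective ?_)⟩
  ext1 x
  rw [← Matrix.mulVec_mulVec, leftMul_mulVec, leftMul_mulVec, hu.octMul_octMul, Matrix.neg_mulVec,
    Matrix.one_mulVec]

theorem IsImagUnit.SO8_rightMul {u : Fin 8 → ℂ} (hu : IsImagUnit u) :
    realMat (rightMul u) ∧ SO8 (rightMul u) := by
  have hr : realMat (rightMul u) := fun i j => (realVec_e j).octMul hu.real i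
  refine ⟨hr, SO8_of_mul_self hr (rightMul_transpose hu.zero) (Matrix.mulVec_injective ?_)⟩
  ext1 x
  rw [← Matrix.mulVec_mulVec, rightMul_mulVec, rightMul_mulVec, octMul_self_octMul hu.zero,
    hu.norm, one_smul, Matrix.neg_mulVec, Matrix.one_mulVec]

theorem e_zero_octMul (x : Fin 8 → ℂ) : octMul (e 0) x = x := by
  ext k
  rw [octMul_eq]
  fin_cases k <;> simp [e]

/-- Left multiplication by an imaginary unit belongs to `Spin(7)`. -/
theorem IsImagUnit.inSpin7_leftMul {u : Fin 8 → ℂ} (hu : IsImagUnit u) : inSpin7 (leftMul u) := by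
  obtain ⟨hl, hl'⟩ := hu.SO8_leftMul
  obtain ⟨hr, hr'⟩ := hu.neg.SO8_rightMul
  refine ⟨hl', hl, leftMul u * rightMul (-u), hl'.mul hr', hl.mul hr, ?_, fun x y => ?_⟩
  · rw [← Matrix.mulVec_mulVec, leftMul_mulVec, rightMul_mulVec, e_zero_octMul, octMul_neg]
    have := hu.octMul_octMul (e 0)
    rw [octMul_e_zero] at this
    rw [this, neg_neg]
  · rw [← Matrix.mulVec_mulVec, leftMul_mulVec, leftMul_mulVec, leftMul_mulVec, rightMul_mulVec,
      octMul_neg, octMul_neg, neg_octMul, ← octMul_moufang, hu.octMul_octMul, octMul_neg, octMul_neg,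
      neg_neg]

theorem neg_bform (x y : Fin 8 → ℂ) : bform (-x) y = -bform x y := by
  simp [bform]

theorem bform_comm (x y : Fin 8 → ℂ) : bform x y = bform y x := by
  simp only [bform, mul_comm]

/-- The product of two orthogonal imaginary units is an imaginary unit. -/
theorem IsImagUnit.mul_of_orthogonal {x y : Fin 8 → ℂ} (hx : IsImagUnit x) (hy : IsImagUnit y)
    (h : bform x y = 0) : IsImagUnit (octMul x y) :=
  ⟨hx.real.octMul hy.real, by rw [octMul_zero, hx.zero, h]; ring,
    by rw [bform_octMul_octMul, hx.norm, hy.norm, one_mul]⟩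

theorem bform_self_pos_of_ne_zero {r : Fin 8 → ℝ} (h : r ≠ 0) : 0 < ∑ i, r i * r i := by
  obtain ⟨i, hi⟩ := Function.ne_iff.mp h
  exact Finset.sum_pos' (fun j _ => mul_self_nonneg _) ⟨i, Finset.mem_univ _, mul_self_pos.mpr hi⟩

/-- Fewer than eight real vectors have a common real unit normal vector. -/
theorem exists_unit_orthogonal {n : ℕ} (hn : n < 8) (c : Fin n → Fin 8 → ℂ)
    (hc : ∀ i, RealVec (c i)) :
    ∃ w : Fin 8 → ℂ, RealVec w ∧ bform w w = 1 ∧ ∀ i, bform w (c i) = 0 := by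
  let A : Matrix (Fin n) (Fin 8) ℝ := Matrix.of fun i j => (c i j).re
  have hk : LinearMap.ker A.mulVecLin ≠ ⊥ :=
    LinearMap.ker_ne_bot_of_finrank_lt (by simpa using hn)
  obtain ⟨r, hr, hr0⟩ := Submodule.exists_mem_ne_zero_of_ne_bot hk
  have hpos := bform_self_pos_of_ne_zero hr0
  set N := ∑ i, r i * r i with hN
  have hs := Real.mul_self_sqrt hpos.le
  have hs0 : √N ≠ 0 := (Real.sqrt_pos.mpr hpos).ne'
  refine ⟨fun i => ((r i / √N : ℝ) : ℂ), fun i => Complex.ofReal_im _, ?_, fun i => ?_⟩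
  · simp only [bform]
    norm_cast
    simp only [div_mul_div_comm, hs, ← Finset.sum_div]
    rw [← hN, div_self hpos.ne']
  · have h1 : ∑ j, (c i j).re * r j = 0 := congrFun (LinearMap.mem_ker.mp hr) i
    have h2 : ∀ j, c i j = ((c i j).re : ℂ) := fun j => Complex.ext rfl (hc i j)
    simp only [bform]
    rw [Finset.sum_congr rfl fun j _ => by rw [h2 j]]
    norm_cast
    have : ∀ j, r j / √N * (c i j).re = (c i j).re * r j / √N := fun j => by ring
    simp only [this, ← Finset.sum_div, h1, zero_div]

/-- Every real unit vector is the image of `e₀` and a unit vector orthogonal to it the image of an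
imaginary unit, under a common element of `Spin(7)`. -/
theorem exists_inSpin7_e_zero {a b : Fin 8 → ℂ} (ha : RealVec a) (hb : RealVec b)
    (ha1 : bform a a = 1) (hb1 : bform b b = 1) (hab : bform a b = 0) :
    ∃ k p, inSpin7 k ∧ IsImagUnit p ∧ k *ᵥ e 0 = a ∧ k *ᵥ p = b := by
  obtain ⟨w, hw, hw1, hwo⟩ := exists_unit_orthogonal (by norm_num) ![e 0, a]
    (by intro i; fin_cases i; exacts [realVec_e 0, ha])
  have hw0 : w 0 = 0 := by simpa [bform, e, Pi.single_apply] using hwo 0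
  have hwa : bform w a = 0 := hwo 1
  have iw : IsImagUnit w := ⟨hw, hw0, hw1⟩
  have iu : IsImagUnit (octMul w a) :=
    ⟨hw.octMul ha, by rw [octMul_zero, hw0, hwa]; ring,
      by rw [bform_octMul_octMul, hw1, ha1, one_mul]⟩
  refine ⟨leftMul w * leftMul (-octMul w a), octMul (-octMul w a) (octMul w b),
    iw.inSpin7_leftMul.mul iu.neg.inSpin7_leftMul, ⟨iu.neg.real.octMul (hw.octMul hb), ?_, ?_⟩, ?_, ?_⟩
  · rw [octMul_zero, iu.neg.zero, neg_bform, bform_octMul_octMul, hab]; ring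
  · rw [bform_octMul_octMul, iu.neg.norm, bform_octMul_octMul, hw1, hb1]; ring
  · rw [← Matrix.mulVec_mulVec, leftMul_mulVec, leftMul_mulVec, octMul_e_zero, octMul_neg,
      iw.octMul_octMul, neg_neg]
  · rw [← Matrix.mulVec_mulVec, leftMul_mulVec, leftMul_mulVec, iu.neg.octMul_octMul, octMul_neg,
      iw.octMul_octMul, neg_neg]

/-- Every imaginary unit arises from `e₁` by the reflection in the line of an imaginary unit. -/
theorem IsImagUnit.exists_reflection {p : Fin 8 → ℂ} (hp : IsImagUnit p) :
    ∃ m, IsImagUnit m ∧ p = (2 * m 1) • m - e 1 := by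
  have hre : ∀ i, p i = ((p i).re : ℂ) := fun i => Complex.ext rfl (hp.real i)
  have hn := hp.norm
  have h0 := hp.zero
  generalize hr : (fun i => (p i).re) = r
  have hre : p = fun i => (r i : ℂ) := by
    ext1 i; rw [hre i, ← hr]
  subst hre
  simp only [bform, Fin.sum_univ_eight] at hn
  norm_cast at hn
  have hr0 : r 0 = 0 := Complex.ofReal_eq_zero.mp h0
  simp only [hr0] at hn
  have h1 : 0 ≤ 1 + r 1 := by
    nlinarith [sq_nonneg (r 2), sq_nonneg (r 3), sq_nonneg (r 4), sq_nonneg (r 5),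
      sq_nonneg (r 6), sq_nonneg (r 7)]
  rcases h1.eq_or_lt with h1 | h1
  · refine ⟨e 2, ⟨realVec_e 2, by simp [e], by simp [bform, e, Fin.sum_univ_eight]⟩, ?_⟩
    have h1 : r 1 = -1 := by linarith
    rw [h1] at hn
    have hz : ∀ i, i ≠ 0 → i ≠ 1 → r i = 0 := by
      intro i hi hi'
      fin_cases i <;> simp at hi hi' ⊢ <;>
      nlinarith [sq_nonneg (r 2), sq_nonneg (r 3), sq_nonneg (r 4), sq_nonneg (r 5),
        sq_nonneg (r 6), sq_nonneg (r 7)]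
    ext i
    fin_cases i <;> simp [e, hr0, h1, hz]
  · set s := √(2 * (1 + r 1))
    have hs : s * s = 2 * (1 + r 1) := Real.mul_self_sqrt (by linarith)
    have hs0 : s ≠ 0 := (Real.sqrt_pos.mpr (by linarith)).ne'
    refine ⟨fun i => (((r i + if i = 1 then 1 else 0) / s : ℝ) : ℂ),
      ⟨fun i => Complex.ofReal_im _, by simp [hr0], ?_⟩, ?_⟩
    · simp only [bform, Fin.sum_univ_eight]
      norm_cast
      simp [hr0]
      field_simp
      linear_combination hn - hs
    · ext i
      by_cases hi : i = 1
      · subst hi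
        have : r 1 = 2 * ((r 1 + 1) / s) * ((r 1 + 1) / s) - 1 := by
          field_simp
          linear_combination (r 1 + 1) * hs
        simp only [Pi.sub_apply, Pi.smul_apply, smul_eq_mul, e, Pi.single_eq_same, if_true]
        exact_mod_cast this
      · have : r i = 2 * ((r 1 + 1) / s) * ((r i + 0) / s) - 0 := by
          field_simp
          linear_combination r i * hs
        simp only [Pi.sub_apply, Pi.smul_apply, smul_eq_mul, e, Pi.single_eq_of_ne hi, if_neg hi,
          if_true]
        exact_mod_cast this

/-- The stabilizer of `e₀` in `Spin(7)` acts transitively on the imaginary units. -/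
theorem IsImagUnit.exists_inSpin7_stabilizer {p : Fin 8 → ℂ} (hp : IsImagUnit p) :
    ∃ k, inSpin7 k ∧ k *ᵥ e 0 = e 0 ∧ k *ᵥ e 1 = p := by
  obtain ⟨m, hm, hpm⟩ := hp.exists_reflection
  let d : Fin 8 → ℂ := e 1 - m 1 • m
  have hd : RealVec d := fun i => by
    simp [d, Complex.mul_im, hm.real i, hm.real 1, realVec_e 1 i]
  have hd0 : d 0 = 0 := by simp [d, hm.zero, e]
  have hm1 := hm.norm
  have hmd : bform m d = 0 := by
    simp only [d, bform, Fin.sum_univ_eight, e] at hm1 ⊢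
    simp
    linear_combination -m 1 * hm1
  obtain ⟨w, hw, hw1, hwo⟩ := exists_unit_orthogonal (by norm_num) ![e 0, m, d, octMul m d]
    (by intro i; fin_cases i; exacts [realVec_e 0, hm.real, hd, hm.real.octMul hd])
  have hw0 : w 0 = 0 := by simpa [bform, e, Pi.single_apply] using hwo 0
  have hwm : bform w m = 0 := hwo 1
  have hwd : bform w d = 0 := hwo 2
  have hwmd : bform w (octMul m d) = 0 := hwo 3
  have iw : IsImagUnit w := ⟨hw, hw0, hw1⟩
  have imw : IsImagUnit (octMul m w) := hm.mul_of_orthogonal iw (by rw [bform_comm, hwm])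
  have hk : ∀ x, (leftMul (octMul m w) * (leftMul w * leftMul m)) *ᵥ x =
      octMul (octMul m w) (octMul w (octMul m x)) := fun x => by
    simp only [← Matrix.mulVec_mulVec, leftMul_mulVec]
  have hmm : octMul m m = -e 0 := by
    simpa only [octMul_e_zero] using hm.octMul_octMul (e 0)
  have km : octMul (octMul m w) (octMul w (octMul m m)) = m := by
    rw [hmm, octMul_neg, octMul_neg, octMul_e_zero, octMul_self_octMul hw0, hw1, one_smul, neg_neg]
  have kd : octMul (octMul m w) (octMul w (octMul m d)) = -d := by
    rw [octMul_anticomm hw0 (by rw [octMul_zero, hm.zero, hmd]; ring) hwmd,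
      octMul_right_anticomm m hd0 hw0 (by rw [bform_comm, hwd]), neg_neg, imw.octMul_octMul]
  refine ⟨leftMul (octMul m w) * (leftMul w * leftMul m),
    imw.inSpin7_leftMul.mul (iw.inSpin7_leftMul.mul hm.inSpin7_leftMul), ?_, ?_⟩
  · rw [hk, octMul_e_zero, octMul_anticomm hw0 hm.zero hwm, octMul_neg]
    simpa only [octMul_e_zero, neg_neg] using congrArg (-·) (imw.octMul_octMul (e 0))
  · have he : e 1 = m 1 • m + d := by simp [d]
    rw [hk, he, octMul_add, octMul_add, octMul_add, octMul_smul, octMul_smul, octMul_smul, km, kd,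
      hpm]
    simp only [d]
    module

/-- `Spin(7)` acts transitively on orthonormal pairs of real vectors. -/
theorem exists_inSpin7_pair {a b : Fin 8 → ℂ} (ha : RealVec a) (hb : RealVec b)
    (ha1 : bform a a = 1) (hb1 : bform b b = 1) (hab : bform a b = 0) :
    ∃ k, inSpin7 k ∧ k *ᵥ e 0 = a ∧ k *ᵥ e 1 = b := by
  obtain ⟨k, p, hk, hp, hka, hkb⟩ := exists_inSpin7_e_zero ha hb ha1 hb1 hab
  obtain ⟨l, hl, hl0, hl1⟩ := hp.exists_inSpin7_stabilizer
  refine ⟨k * l, hk.mul hl, ?_, ?_⟩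
  · rw [← Matrix.mulVec_mulVec, hl0, hka]
  · rw [← Matrix.mulVec_mulVec, hl1, hkb]

/-- A point of the complex unit sphere is a hyperbolic combination of an orthonormal pair. -/
theorem exists_orthonormal_pair {v : Fin 8 → ℂ} (hv : bform v v = 1) :
    ∃ (a b : Fin 8 → ℂ) (θ : ℝ), RealVec a ∧ RealVec b ∧ bform a a = 1 ∧ bform b b = 1 ∧
      bform a b = 0 ∧
      v = (Real.cosh θ : ℂ) • a + (Complex.I * (Real.sinh θ : ℂ)) • b := by
  have hre := congrArg Complex.re hv
  have him := congrArg Complex.im hv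
  simp only [bform, Complex.re_sum, Complex.im_sum, Complex.mul_re, Complex.mul_im,
    Complex.one_re, Complex.one_im, Finset.sum_sub_distrib, Finset.sum_add_distrib] at hre him
  have hxy : ∑ i, (v i).re * (v i).im = 0 := by
    have : ∑ i, (v i).im * (v i).re = ∑ i, (v i).re * (v i).im :=
      Finset.sum_congr rfl fun i _ => mul_comm _ _
    linarith
  set B := ∑ i, (v i).im * (v i).im with hB
  have hB0 : 0 ≤ B := Finset.sum_nonneg fun i _ => mul_self_nonneg _
  set θ := Real.arsinh √B
  have hsh : Real.sinh θ = √B := Real.sinh_arsinh _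
  have hs : √B * √B = B := Real.mul_self_sqrt hB0
  have hch : Real.cosh θ * Real.cosh θ = 1 + B := by
    have := Real.cosh_sq θ
    rw [hsh] at this
    linarith
  have hc0 : Real.cosh θ ≠ 0 := (Real.cosh_pos θ).ne'
  let a : Fin 8 → ℂ := fun i => (((v i).re / Real.cosh θ : ℝ) : ℂ)
  have ha : RealVec a := fun i => Complex.ofReal_im _
  have ha1 : bform a a = 1 := by
    simp only [bform, a]
    norm_cast
    simp only [div_mul_div_comm, ← Finset.sum_div, hch]
    rw [show ∑ i, (v i).re * (v i).re = 1 + B by linarith, div_self (by linarith)]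
  have hca : ∀ i, (Real.cosh θ : ℂ) * a i = (v i).re := fun i => by
    simp only [a]
    norm_cast
    field_simp
  rcases hB0.eq_or_lt with hz | hpos
  · obtain ⟨b, hb, hb1, hba⟩ := exists_unit_orthogonal (by norm_num) ![a]
      (by intro i; fin_cases i; exact ha)
    refine ⟨a, b, θ, ha, hb, ha1, hb1, by rw [bform_comm]; exact hba 0, ?_⟩
    have hi : ∀ i, (v i).im = 0 := fun i => by
      have := (Finset.sum_eq_zero_iff_of_nonneg fun i _ => mul_self_nonneg (v i).im).mp
        (hB ▸ hz.symm) i (Finset.mem_univ i)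
      exact mul_self_eq_zero.mp this
    ext1 i
    simp only [Pi.add_apply, Pi.smul_apply, smul_eq_mul, hsh, ← hz, Real.sqrt_zero, hca]
    apply Complex.ext <;> simp [hi]
  · have hs0 : √B ≠ 0 := (Real.sqrt_pos.mpr hpos).ne'
    refine ⟨a, fun i => (((v i).im / √B : ℝ) : ℂ), θ, ha, fun i => Complex.ofReal_im _, ha1,
      ?_, ?_, ?_⟩
    · simp only [bform]
      norm_cast
      simp only [div_mul_div_comm, ← Finset.sum_div, hs]
      rw [← hB, div_self hpos.ne']
    · simp only [bform, a]
      norm_cast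
      simp only [div_mul_div_comm, ← Finset.sum_div, hxy, zero_div]
    · ext1 i
      simp only [Pi.add_apply, Pi.smul_apply, smul_eq_mul, hsh, hca]
      rw [mul_assoc, ← Complex.ofReal_mul (√B), mul_div_cancel₀ _ hs0, mul_comm Complex.I]
      exact (Complex.re_add_im _).symm

/-- **Lemma `lem:spin7-sphere`.** Every point of the complex unit sphere `S_ℂ^7` lies
in the `Spin(7)`-orbit of the slice `T̃₀ = {cosh θ · e₀ + i sinh θ · e₁ : θ ∈ ℝ}`:
for every `v ∈ ℂ^8` with `(v, v) = 1` there exist `k ∈ Spin(7)` and `θ ∈ ℝ` such that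
`v = k (cosh θ · e₀ + i sinh θ · e₁)`. -/
theorem stmt11 (v : Fin 8 → ℂ) (hv : bform v v = 1) :
    ∃ (k : Matrix (Fin 8) (Fin 8) ℂ) (θ : ℝ), inSpin7 k ∧
      v = k.mulVec ((Real.cosh θ : ℂ) • e 0 + (Complex.I * (Real.sinh θ : ℂ)) • e 1) := by
  obtain ⟨a, b, θ, ha, hb, ha1, hb1, hab, hv⟩ := exists_orthonormal_pair hv
  obtain ⟨k, hk, hka, hkb⟩ := exists_inSpin7_pair ha hb ha1 hb1 hab
  refine ⟨k, θ, hk, ?_⟩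
  rw [Matrix.mulVec_add, Matrix.mulVec_smul, Matrix.mulVec_smul, hka, hkb, hv]
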